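/- (Global sensitivity bound.) Assume b_j − ε_j ≤ (A η)_j ≤ b_j + ε_j for every j, and let g^{bf} ∈ Δ_k^n attain sup_{g ∈ Δ_k^n} inf_{z ∈ P(b,ε)} z·log g. Then for every θ ∈ ℝ^m, writing θ_j⁺ = max(θ_j,0) and θ_j⁻ = max(−θ_j,0): −η·log g^{bf} ≤ −g^{(θ)}·log g^{(θ)} + Σ_j θ_j·( (A g^{(θ)})_j − (A η)_j ) + Σ_j ( b_j + ε_j − (A η)_j )·θ_j⁻ + Σ_j ( (A η)_j − b_j + ε_j )·θ_j⁺. -/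

import Mathlib

open Finset

attribute [local instance] Classical.propDecidable

noncomputable section

/-- The simplex `Δ_k^n`: rows are probability distributions over `Fin k`. -/
def Simplex (n k : ℕ) : Set (Fin n → Fin k → ℝ) :=
  {z | (∀ i ℓ, 0 ≤ z i ℓ) ∧ ∀ i, ∑ ℓ, z i ℓ = 1}

/-- Number of points where rule `j` does not abstain. -/
def nRule {n k p : ℕ} (h : Fin p → Fin n → Option (Fin k)) (j : Fin p) : ℕ :=
  (Finset.univ.filter (fun i => h j i ≠ none)).card

/-- The constraint matrix `A`, with `m = p + k` rows indexed by `Fin p ⊕ Fin k`. -/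
def Amat {n k p : ℕ} (h : Fin p → Fin n → Option (Fin k)) :
    Fin p ⊕ Fin k → Fin n → Fin k → ℝ
  | Sum.inl j => fun i ℓ => if h j i = some ℓ then 1 / (nRule h j : ℝ) else 0
  | Sum.inr ℓ' => fun i ℓ => if ℓ = ℓ' then 1 / (n : ℝ) else 0

/-- `(A z)_j`. -/
def applyA {n k p : ℕ} (h : Fin p → Fin n → Option (Fin k))
    (z : Fin n → Fin k → ℝ) (j : Fin p ⊕ Fin k) : ℝ :=
  ∑ i, ∑ ℓ, Amat h j i ℓ * z i ℓ

/-- The polytope `P(b, ε)`. -/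
def Polytope {n k p : ℕ} (h : Fin p → Fin n → Option (Fin k))
    (b ε : Fin p ⊕ Fin k → ℝ) : Set (Fin n → Fin k → ℝ) :=
  {z | z ∈ Simplex n k ∧ ∀ j, b j - ε j ≤ applyA h z j ∧ applyA h z j ≤ b j + ε j}

/-- Extended-real logarithm, with `elog 0 = ⊥ = -∞`. -/
def elog (x : ℝ) : EReal := if x = 0 then ⊥ else ((Real.log x : ℝ) : EReal)

/-- `z · log g`, valued in `[-∞, 0]` with the convention `0 · log 0 = 0`. -/
def dotlog {n k : ℕ} (z g : Fin n → Fin k → ℝ) : EReal :=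
  ∑ i, ∑ ℓ, (z i ℓ : EReal) * elog (g i ℓ)

/-- `a^{(θ)}_{iℓ} = Σ_j θ_j · A j i ℓ`. -/
def avec {n k p : ℕ} (h : Fin p → Fin n → Option (Fin k))
    (θ : Fin p ⊕ Fin k → ℝ) (i : Fin n) (ℓ : Fin k) : ℝ :=
  ∑ j, θ j * Amat h j i ℓ

/-- The exponential-family (softmax) prediction `g^{(θ)}`. -/
def gexp {n k p : ℕ} (h : Fin p → Fin n → Option (Fin k))
    (θ : Fin p ⊕ Fin k → ℝ) (i : Fin n) (ℓ : Fin k) : ℝ :=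
  Real.exp (avec h θ i ℓ) / ∑ ℓ', Real.exp (avec h θ i ℓ')

/-- The BF dual objective `(σ'−σ)·b − (σ'+σ)·ε − Σ_i log(Σ_ℓ exp(a^{(σ'−σ)}_{iℓ}))`. -/
def dualObj {n k p : ℕ} (h : Fin p → Fin n → Option (Fin k))
    (b ε σ σ' : Fin p ⊕ Fin k → ℝ) : ℝ :=
  (∑ j, (σ' j - σ j) * b j) - (∑ j, (σ' j + σ j) * ε j)
    - ∑ i, Real.log (∑ ℓ, Real.exp (avec h (fun j => σ' j - σ j) i ℓ))

/-- KL summand `a·log(a/c)`, with `0·log(0/c) = 0` and `a·log(a/0) = ⊤` for `a ≠ 0`. -/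
def klTerm (a c : ℝ) : EReal :=
  if a = 0 then 0 else if c = 0 then ⊤ else ((a * Real.log (a / c) : ℝ) : EReal)

/-- `d(μ, ν)`, the summed KL divergences, valued in `[0, +∞]`. -/
def dKL {n k : ℕ} (μ ν : Fin n → Fin k → ℝ) : EReal :=
  ∑ i, ∑ ℓ, klTerm (μ i ℓ) (ν i ℓ)

/-- Unnormalized one-coin Dawid–Skene score `N_{iℓ}`. -/
def Nds {n k p : ℕ} (h : Fin p → Fin n → Option (Fin k))
    (w : Fin k → ℝ) (β : Fin p → ℝ) (i : Fin n) (ℓ : Fin k) : ℝ :=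
  w ℓ * (∏ j ∈ Finset.univ.filter (fun j => h j i = some ℓ), β j)
    * ∏ j ∈ Finset.univ.filter (fun j => ∃ ℓ' ≠ ℓ, h j i = some ℓ'),
        (1 - β j) / ((k : ℝ) - 1)

/-- The one-coin Dawid–Skene prediction `g^{ds}(w, β)`. -/
def gds {n k p : ℕ} (h : Fin p → Fin n → Option (Fin k))
    (w : Fin k → ℝ) (β : Fin p → ℝ) (i : Fin n) (ℓ : Fin k) : ℝ :=
  Nds h w β i ℓ / ∑ ℓ', Nds h w β i ℓ'

/-- The log-normalizer `Σ_i log Σ_ℓ exp a^{(θ)}_{iℓ}` of the softmax prediction. -/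
def logPartition {n k p : ℕ} (h : Fin p → Fin n → Option (Fin k))
    (θ : Fin p ⊕ Fin k → ℝ) : ℝ :=
  ∑ i, Real.log (∑ ℓ, Real.exp (avec h θ i ℓ))

theorem EReal_coe_finset_sum {ι : Type*} (s : Finset ι) (f : ι → ℝ) :
    ((∑ i ∈ s, f i : ℝ) : EReal) = ∑ i ∈ s, (f i : EReal) :=
  map_sum (⟨⟨Real.toEReal, EReal.coe_zero⟩, EReal.coe_add⟩ : ℝ →+ EReal) f s

theorem sum_exp_avec_pos {n k p : ℕ} (hk : 0 < k) (h : Fin p → Fin n → Option (Fin k))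
    (θ : Fin p ⊕ Fin k → ℝ) (i : Fin n) : 0 < ∑ ℓ, Real.exp (avec h θ i ℓ) :=
  Finset.sum_pos (fun _ _ => Real.exp_pos _) ⟨⟨0, hk⟩, Finset.mem_univ _⟩

theorem gexp_pos {n k p : ℕ} (hk : 0 < k) (h : Fin p → Fin n → Option (Fin k))
    (θ : Fin p ⊕ Fin k → ℝ) (i : Fin n) (ℓ : Fin k) : 0 < gexp h θ i ℓ :=
  div_pos (Real.exp_pos _) (sum_exp_avec_pos hk h θ i)

theorem gexp_mem_simplex {n k p : ℕ} (hk : 0 < k) (h : Fin p → Fin n → Option (Fin k))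
    (θ : Fin p ⊕ Fin k → ℝ) : gexp h θ ∈ Simplex n k := by
  refine ⟨fun i ℓ => (gexp_pos hk h θ i ℓ).le, fun i => ?_⟩
  simp only [gexp]
  rw [← Finset.sum_div, div_self (sum_exp_avec_pos hk h θ i).ne']

theorem sum_mul_avec {n k p : ℕ} (h : Fin p → Fin n → Option (Fin k))
    (θ : Fin p ⊕ Fin k → ℝ) (z : Fin n → Fin k → ℝ) :
    ∑ i, ∑ ℓ, z i ℓ * avec h θ i ℓ = ∑ j, θ j * applyA h z j := by
  simp only [avec, applyA, Finset.mul_sum]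
  rw [Finset.sum_comm' (s := (Finset.univ : Finset (Fin p ⊕ Fin k)))
    (t := fun _ => Finset.univ) (t' := Finset.univ) (s' := fun _ => Finset.univ) (by simp)]
  refine Finset.sum_congr rfl fun i _ => ?_
  rw [Finset.sum_comm]
  exact Finset.sum_congr rfl fun j _ => Finset.sum_congr rfl fun ℓ _ => by ring

theorem sum_mul_log_gexp {n k p : ℕ} (hk : 0 < k) (h : Fin p → Fin n → Option (Fin k))
    (θ : Fin p ⊕ Fin k → ℝ) {z : Fin n → Fin k → ℝ} (hz : z ∈ Simplex n k) :
    ∑ i, ∑ ℓ, z i ℓ * Real.log (gexp h θ i ℓ)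
      = ∑ j, θ j * applyA h z j - logPartition h θ := by
  rw [← sum_mul_avec, logPartition, ← Finset.sum_sub_distrib]
  refine Finset.sum_congr rfl fun i _ => ?_
  have hlog : ∀ ℓ, Real.log (gexp h θ i ℓ)
      = avec h θ i ℓ - Real.log (∑ ℓ', Real.exp (avec h θ i ℓ')) := fun ℓ => by
    rw [gexp, Real.log_div (Real.exp_ne_zero _) (sum_exp_avec_pos hk h θ i).ne', Real.log_exp]
  simp only [hlog, mul_sub, Finset.sum_sub_distrib]
  rw [← Finset.sum_mul, hz.2 i, one_mul]

theorem dotlog_gexp {n k p : ℕ} (hk : 0 < k) (h : Fin p → Fin n → Option (Fin k))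
    (θ : Fin p ⊕ Fin k → ℝ) {z : Fin n → Fin k → ℝ} (hz : z ∈ Simplex n k) :
    dotlog z (gexp h θ)
      = ((∑ j, θ j * applyA h z j - logPartition h θ : ℝ) : EReal) := by
  rw [← sum_mul_log_gexp hk h θ hz]
  simp only [dotlog, elog, (gexp_pos hk h θ _ _).ne', if_false, EReal_coe_finset_sum,
    EReal.coe_mul]

/-- Weak duality: the value of the softmax prediction over the polytope. -/
theorem le_iInf_dotlog_gexp {n k p : ℕ} (hk : 0 < k) (h : Fin p → Fin n → Option (Fin k))
    (b ε θ : Fin p ⊕ Fin k → ℝ) :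
    ((∑ j, (θ j * b j - |θ j| * ε j) - logPartition h θ : ℝ) : EReal)
      ≤ ⨅ z ∈ Polytope h b ε, dotlog z (gexp h θ) := by
  refine le_iInf₂ fun z hz => ?_
  rw [dotlog_gexp hk h θ hz.1, EReal.coe_le_coe_iff]
  refine sub_le_sub_right (Finset.sum_le_sum fun j _ => ?_) _
  obtain ⟨hl, hu⟩ := hz.2 j
  have hab : |b j - applyA h z j| ≤ ε j := abs_le.2 ⟨by linarith, by linarith⟩
  have := (le_abs_self (θ j * (b j - applyA h z j))).trans
    ((abs_mul _ _).trans_le (mul_le_mul_of_nonneg_left hab (abs_nonneg (θ j))))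
  linarith

/-- global sensitivity bound. -/
theorem stmt14 {n k p : ℕ} (hn : 0 < n) (hk : 2 ≤ k) (hp : 0 < p)
    (h : Fin p → Fin n → Option (Fin k)) (hnj : ∀ j, 0 < nRule h j)
    (η : Fin n → Fin k → ℝ) (hη : η ∈ Simplex n k)
    (b ε : Fin p ⊕ Fin k → ℝ)
    (hmem : ∀ j, b j - ε j ≤ applyA h η j ∧ applyA h η j ≤ b j + ε j)
    (gbf : Fin n → Fin k → ℝ) (hgbf : gbf ∈ Simplex n k)
    (hopt : (⨅ z ∈ Polytope h b ε, dotlog z gbf)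
        = ⨆ g ∈ Simplex n k, ⨅ z ∈ Polytope h b ε, dotlog z g)
    (θ : Fin p ⊕ Fin k → ℝ) :
    -(dotlog η gbf)
      ≤ (((-(∑ i, ∑ ℓ, gexp h θ i ℓ * Real.log (gexp h θ i ℓ)))
          + (∑ j, θ j * (applyA h (gexp h θ) j - applyA h η j))
          + (∑ j, (b j + ε j - applyA h η j) * max (-θ j) 0)
          + ∑ j, (applyA h η j - b j + ε j) * max (θ j) 0 : ℝ) : EReal) := by
  have hk' : 0 < k := by omega
  have hlow : ((∑ j, (θ j * b j - |θ j| * ε j) - logPartition h θ : ℝ) : EReal)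
      ≤ dotlog η gbf :=
    calc _ ≤ ⨅ z ∈ Polytope h b ε, dotlog z (gexp h θ) := le_iInf_dotlog_gexp hk' h b ε θ
      _ ≤ ⨆ g ∈ Simplex n k, ⨅ z ∈ Polytope h b ε, dotlog z g :=
        le_iSup₂ (f := fun g (_ : g ∈ Simplex n k) => ⨅ z ∈ Polytope h b ε, dotlog z g)
          _ (gexp_mem_simplex hk' h θ)
      _ = ⨅ z ∈ Polytope h b ε, dotlog z gbf := hopt.symm
      _ ≤ dotlog η gbf := iInf₂_le η ⟨hη, hmem⟩
  refine (EReal.neg_le_neg_iff.2 hlow).trans ?_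
  rw [← EReal.coe_neg, EReal.coe_le_coe_iff, sum_mul_log_gexp hk' h θ (gexp_mem_simplex hk' h θ)]
  have hsum : (∑ j, θ j * (applyA h (gexp h θ) j - applyA h η j))
      + (∑ j, (b j + ε j - applyA h η j) * max (-θ j) 0)
      + ∑ j, (applyA h η j - b j + ε j) * max (θ j) 0
      = ∑ j, θ j * applyA h (gexp h θ) j - ∑ j, (θ j * b j - |θ j| * ε j) := by
    rw [← Finset.sum_add_distrib, ← Finset.sum_add_distrib, ← Finset.sum_sub_distrib]
    refine Finset.sum_congr rfl fun j _ => ?_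
    rcases le_total 0 (θ j) with hj | hj
    · rw [max_eq_right (neg_nonpos.2 hj), max_eq_left hj, abs_of_nonneg hj]
      ring
    · rw [max_eq_left (neg_nonneg.2 hj), max_eq_right hj, abs_of_nonpos hj]
      ring
  linarith
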